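/- There is no isometric embedding j of N ⊕ N into E8(−1) ⊕ E8(−1) such that j(N ⊕ {0}) is a primitive sublattice of E8(−1) ⊕ E8(−1). -/

import Mathlib

open Matrix Finset

/-- The ambient space `N ⊗ ℚ = ℚ^8` of the Nikulin lattice. -/
abbrev Qv : Type := Fin 8 → ℚ

/-- The basis vectors `N₁, …, N₈`. -/
def Nvec (i : Fin 8) : Qv := Pi.single i (1 : ℚ)

/-- The vector `N̂ = (N₁ + ⋯ + N₈)/2`. -/
def Nhat : Qv := fun _ => 1 / 2

/-- The Nikulin lattice `N`. -/
def Nik : Submodule ℤ Qv := Submodule.span ℤ (insert Nhat (Set.range Nvec))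

/-- The bilinear form `b(x, y) = -2 ∑ xᵢ yᵢ` of the Nikulin lattice. -/
def bN (x y : Qv) : ℚ := -2 * ∑ i, x i * y i

/-- The lattice `N ⊕ N` inside `(N ⊕ N) ⊗ ℚ`. -/
def NN : Submodule ℤ (Qv × Qv) := Nik.prod Nik

/-- The orthogonal direct sum form on `(N ⊕ N) ⊗ ℚ`. -/
def bNN (x y : Qv × Qv) : ℚ := bN x.1 y.1 + bN x.2 y.2

/-- The bilinear form of `E8(-1)`: the negative of the E8 Cartan matrix pairing. -/
def bE8 (x y : Fin 8 → ℤ) : ℤ := -(x ⬝ᵥ (CartanMatrix.E₈ *ᵥ y))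

/-- The underlying `ℤ`-module of `E8(-1) ⊕ E8(-1)`. -/
abbrev E2T : Type := (Fin 8 → ℤ) × (Fin 8 → ℤ)

/-- The bilinear form of `E8(-1) ⊕ E8(-1)`. -/
def bE2 (x y : E2T) : ℤ := bE8 x.1 y.1 + bE8 x.2 y.2

/-- The inverse of the `E₈` Cartan matrix. -/
def E8inv : Matrix (Fin 8) (Fin 8) ℤ :=
  !![4, 5, 7, 10, 8, 6, 4, 2;
     5, 8, 10, 15, 12, 9, 6, 3;
     7, 10, 14, 20, 16, 12, 8, 4;
     10, 15, 20, 30, 24, 18, 12, 6;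
     8, 12, 16, 24, 20, 15, 10, 5;
     6, 9, 12, 18, 15, 12, 8, 4;
     4, 6, 8, 12, 10, 8, 6, 3;
     2, 3, 4, 6, 5, 4, 3, 2]

theorem E8inv_mul : E8inv * CartanMatrix.E₈ = 1 := by decide +kernel

/-- The quadratic form of `E8(-1)` in coordinates. -/
theorem bE8_self (x : Fin 8 → ℤ) : bE8 x x =
    -2 * (x 0 ^ 2 + x 1 ^ 2 + x 2 ^ 2 + x 3 ^ 2 + x 4 ^ 2 + x 5 ^ 2 + x 6 ^ 2 + x 7 ^ 2
      - x 0 * x 2 - x 1 * x 3 - x 2 * x 3 - x 3 * x 4 - x 4 * x 5 - x 5 * x 6 - x 6 * x 7) := by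
  simp [bE8, CartanMatrix.E₈, dotProduct, Matrix.mulVec, Fin.sum_univ_succ]
  ring

/-- `E8(-1)` is negative definite. -/
theorem bE8_self_le (x : Fin 8 → ℤ) : bE8 x x ≤ 0 ∧ (bE8 x x = 0 → x = 0) := by
  have key : -60 * bE8 x x = 30 * (2 * x 1 - x 3) ^ 2 + 30 * (2 * x 0 - x 2) ^ 2
      + 10 * (3 * x 2 - 2 * x 3) ^ 2 + 30 * (2 * x 7 - x 6) ^ 2 + 10 * (3 * x 6 - 2 * x 5) ^ 2
      + 5 * (4 * x 5 - 3 * x 4) ^ 2 + 3 * (5 * x 4 - 4 * x 3) ^ 2 + 2 * x 3 ^ 2 := by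
    rw [bE8_self]; ring
  have h1 := sq_nonneg (2 * x 1 - x 3)
  have h2 := sq_nonneg (2 * x 0 - x 2)
  have h3 := sq_nonneg (3 * x 2 - 2 * x 3)
  have h4 := sq_nonneg (2 * x 7 - x 6)
  have h5 := sq_nonneg (3 * x 6 - 2 * x 5)
  have h6 := sq_nonneg (4 * x 5 - 3 * x 4)
  have h7 := sq_nonneg (5 * x 4 - 4 * x 3)
  have h8 := sq_nonneg (x 3)
  refine ⟨by linarith, fun h => ?_⟩
  have e1 := pow_eq_zero_iff two_ne_zero |>.1 (le_antisymm (by linarith) h1)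
  have e2 := pow_eq_zero_iff two_ne_zero |>.1 (le_antisymm (by linarith) h2)
  have e3 := pow_eq_zero_iff two_ne_zero |>.1 (le_antisymm (by linarith) h3)
  have e4 := pow_eq_zero_iff two_ne_zero |>.1 (le_antisymm (by linarith) h4)
  have e5 := pow_eq_zero_iff two_ne_zero |>.1 (le_antisymm (by linarith) h5)
  have e6 := pow_eq_zero_iff two_ne_zero |>.1 (le_antisymm (by linarith) h6)
  have e7 := pow_eq_zero_iff two_ne_zero |>.1 (le_antisymm (by linarith) h7)
  have e8 := pow_eq_zero_iff two_ne_zero |>.1 (le_antisymm (by linarith) h8)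
  ext i
  fin_cases i <;> simp <;> omega

/-- Every vector of square `-2` in `E8(-1) ⊕ E8(-1)` lies in one of the two summands. -/
theorem fst_eq_zero_or_snd_eq_zero {x : E2T} (h : bE2 x x = -2) : x.1 = 0 ∨ x.2 = 0 := by
  obtain ⟨h1, h1'⟩ := bE8_self_le x.1
  obtain ⟨h2, h2'⟩ := bE8_self_le x.2
  have e1 := bE8_self x.1
  have e2 := bE8_self x.2
  unfold bE2 at h
  rcases eq_or_ne (bE8 x.1 x.1) 0 with h0 | h0
  · exact .inl (h1' h0)
  · exact .inr (h2' (by omega))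

/-- `E8(-1)` is unimodular, so a vector pairing evenly with everything is divisible by two. -/
theorem exists_eq_two_smul {w : Fin 8 → ℤ} (h : ∀ y, Even (bE8 y w)) :
    ∃ u : Fin 8 → ℤ, w = (2 : ℤ) • u := by
  have hc : ∀ i, ∃ c : ℤ, (CartanMatrix.E₈ *ᵥ w) i = 2 * c := fun i => by
    obtain ⟨c, hc⟩ := h (Pi.single i 1)
    refine ⟨-c, ?_⟩
    simp only [bE8, single_one_dotProduct] at hc
    omega
  choose c hc using hc
  refine ⟨E8inv *ᵥ c, ?_⟩
  have hw : CartanMatrix.E₈ *ᵥ w = (2 : ℤ) • c := by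
    ext i
    simp [hc]
  rw [← Matrix.mulVec_smul, ← hw, Matrix.mulVec_mulVec, E8inv_mul, Matrix.one_mulVec]

/-- Eight pairwise orthogonal roots of `E8(-1)` span it up to index a power of two. -/
theorem two_smul_eq_sum_roots (r : Matrix (Fin 8) (Fin 8) ℤ)
    (h : ∀ i k, bE8 (r i) (r k) = if i = k then -2 else 0) (y : Fin 8 → ℤ) :
    ∃ c : Fin 8 → ℤ, (2 : ℤ) • y = ∑ i, c i • r i := by
  have hr : (r * CartanMatrix.E₈) * rᵀ = (2 : ℤ) • (1 : Matrix (Fin 8) (Fin 8) ℤ) := by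
    ext i k
    have := h i k
    rw [bE8, Matrix.dotProduct_mulVec] at this
    have e : ((r * CartanMatrix.E₈) * rᵀ) i k = (r i ᵥ* CartanMatrix.E₈) ⬝ᵥ r k := rfl
    rw [e, Matrix.smul_apply, Matrix.one_apply]
    split_ifs at this ⊢ <;> simp <;> omega
  have hdet : (r * CartanMatrix.E₈).det ≠ 0 := by
    intro h0
    have := congrArg Matrix.det hr
    rw [Matrix.det_mul, h0, Matrix.det_smul] at this
    simp at this
  refine ⟨(r * CartanMatrix.E₈) *ᵥ y, ?_⟩
  have hz : (2 : ℤ) • y - rᵀ *ᵥ ((r * CartanMatrix.E₈) *ᵥ y) = 0 := by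
    apply Matrix.eq_zero_of_mulVec_eq_zero hdet
    rw [Matrix.mulVec_sub, Matrix.mulVec_mulVec _ _ rᵀ, hr, Matrix.mulVec_smul,
      Matrix.smul_mulVec, Matrix.one_mulVec, sub_self]
  rw [sub_eq_zero.1 hz]
  ext k
  simp [Matrix.mulVec, dotProduct, mul_comm]

/-- The coordinates of a vector of the Nikulin lattice are all integers or all half-odd. -/
theorem exists_coord_of_mem_Nik {x : Qv} (hx : x ∈ Nik) :
    ∃ (m : ℤ) (a : Fin 8 → ℤ), ∀ i, x i = a i + m / 2 := by
  obtain ⟨m, z, hz, rfl⟩ := Submodule.mem_span_insert.1 hx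
  obtain ⟨a, rfl⟩ := (Submodule.mem_span_range_iff_exists_fun ℤ).1 hz
  refine ⟨m, a, fun i => ?_⟩
  simp [Nhat, Nvec, Pi.single_apply]
  ring

/-- The vector `Nᵢ` as an element of the Nikulin lattice. -/
def nikVec (i : Fin 8) : Nik :=
  ⟨Nvec i, Submodule.subset_span (Set.mem_insert_of_mem _ ⟨i, rfl⟩)⟩

theorem coe_sum_smul_nikVec (c : Fin 8 → ℤ) (k : Fin 8) :
    ((∑ i, c i • nikVec i : Nik) : Qv) k = c k := by
  simp [nikVec, Nvec, Pi.single_apply]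

theorem two_smul_eq_sum_nikVec (v : Nik) :
    ∃ c : Fin 8 → ℤ, (2 : ℤ) • v = ∑ i, c i • nikVec i := by
  obtain ⟨m, a, h⟩ := exists_coord_of_mem_Nik v.2
  refine ⟨fun i => 2 * a i + m, Subtype.ext (funext fun k => ?_)⟩
  rw [coe_sum_smul_nikVec]
  simp [h]
  ring

theorem bN_nikVec (i k : Fin 8) : bN (nikVec i) (nikVec k) = if i = k then -2 else 0 := by
  simp [bN, nikVec, Nvec, Pi.single_apply, eq_comm]

/-- The Nikulin lattice has no primitive isometric embedding with all `Nᵢ` in the first summand. -/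
theorem exists_snd_ne_zero (f : Nik →ₗ[ℤ] E2T) (hinj : Function.Injective f)
    (hf : ∀ x y : Nik, (bE2 (f x) (f y) : ℚ) = bN x y)
    (hp : ∀ (p : E2T) (n : ℤ), n ≠ 0 → n • p ∈ LinearMap.range f → p ∈ LinearMap.range f) :
    ∃ i, (f (nikVec i)).2 ≠ 0 := by
  by_contra! h0
  have hb : ∀ i k, bE8 (f (nikVec i)).1 (f (nikVec k)).1 = if i = k then -2 else 0 := by
    intro i k
    have h := hf (nikVec i) (nikVec k)
    rw [bN_nikVec, bE2, h0 i] at h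
    simp only [bE8, zero_dotProduct, neg_zero, add_zero] at h ⊢
    exact_mod_cast h
  have hmem : ∀ y : Fin 8 → ℤ, ((y, 0) : E2T) ∈ LinearMap.range f := by
    intro y
    obtain ⟨c, hc⟩ := two_smul_eq_sum_roots (fun i => (f (nikVec i)).1) hb y
    refine hp _ 2 two_ne_zero ⟨∑ i, c i • nikVec i, ?_⟩
    rw [map_sum]
    refine Prod.ext ?_ ?_
    · rw [Prod.fst_sum]; simpa using hc.symm
    · rw [Prod.snd_sum]; simp [h0]
  obtain ⟨u, hu⟩ := exists_eq_two_smul (w := (f (nikVec 0 + nikVec 1)).1) fun y => by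
    obtain ⟨v, hv⟩ := hmem y
    obtain ⟨m, a, ha⟩ := exists_coord_of_mem_Nik v.2
    have h := hf v (nikVec 0 + nikVec 1)
    have e : bN v (nikVec 0 + nikVec 1 : Nik) = -2 * ((v : Qv) 0 + (v : Qv) 1) := by
      simp [bN, nikVec, Nvec, Pi.single_apply, mul_add, sum_add_distrib]
    rw [e, hv, bE2, ha, ha] at h
    have e2 : bE8 (0 : Fin 8 → ℤ) (f (nikVec 0 + nikVec 1)).2 = 0 := by simp [bE8]
    rw [e2] at h
    refine ⟨-(a 0 + a 1 + m), ?_⟩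
    have h' : ((bE8 y (f (nikVec 0 + nikVec 1)).1 : ℤ) : ℚ)
        = ((-(a 0 + a 1 + m) + -(a 0 + a 1 + m) : ℤ) : ℚ) := by
      push_cast at h ⊢
      linarith
    exact_mod_cast h'
  obtain ⟨v, hv⟩ := hmem u
  have hv2 : (2 : ℤ) • v = nikVec 0 + nikVec 1 := by
    apply hinj
    rw [map_smul, hv]
    refine Prod.ext hu.symm ?_
    simp [h0]
  obtain ⟨m, a, ha⟩ := exists_coord_of_mem_Nik v.2
  have c0 := congrFun (congrArg Subtype.val hv2) 0
  have c2 := congrFun (congrArg Subtype.val hv2) 2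
  simp [nikVec, Nvec, ha] at c0 c2
  have d0 : 2 * a 0 + m = 1 := by
    have : (2 * a 0 + m : ℚ) = 1 := by linarith
    exact_mod_cast this
  have d2 : 2 * a 2 + m = 0 := by
    have : (2 * a 2 + m : ℚ) = 0 := by linarith
    exact_mod_cast this
  omega

/-- The Nikulin lattice has no primitive isometric embedding into `E8(-1) ⊕ E8(-1)`. -/
theorem no_primitive_embedding_Nik (f : Nik →ₗ[ℤ] E2T) (hinj : Function.Injective f)
    (hf : ∀ x y : Nik, (bE2 (f x) (f y) : ℚ) = bN x y)
    (hp : ∀ (p : E2T) (n : ℤ), n ≠ 0 → n • p ∈ LinearMap.range f → p ∈ LinearMap.range f) :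
    False := by
  have hroot : ∀ i, (f (nikVec i)).1 = 0 ∨ (f (nikVec i)).2 = 0 := fun i => by
    apply fst_eq_zero_or_snd_eq_zero
    have h := hf (nikVec i) (nikVec i)
    rw [bN_nikVec, if_pos rfl] at h
    exact_mod_cast h
  obtain ⟨s, hs⟩ := exists_snd_ne_zero f hinj hf hp
  let σ : E2T ≃ₗ[ℤ] E2T := LinearEquiv.prodComm ℤ _ _
  obtain ⟨t, ht⟩ := exists_snd_ne_zero (σ.toLinearMap ∘ₗ f) (σ.injective.comp hinj)
    (fun x y => by
      rw [← hf, bE2, bE2, add_comm]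
      rfl)
    (fun p n hn ⟨v, hv⟩ => by
      obtain ⟨w, hw⟩ := hp (σ p) n hn ⟨v, by
        rw [← map_smul, ← hv]
        rfl⟩
      refine ⟨w, ?_⟩
      rw [LinearMap.comp_apply, hw]
      rfl)
  replace ht : (f (nikVec t)).1 ≠ 0 := ht
  let nh : Nik := ⟨Nhat, Submodule.subset_span (Set.mem_insert _ _)⟩
  have hnh : (2 : ℤ) • nh = ∑ i, nikVec i := by
    refine Subtype.ext (funext fun k => ?_)
    have := coe_sum_smul_nikVec (fun _ => 1) k
    simp only [one_smul] at this
    rw [this]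
    simp [nh, Nhat]
  let c : Fin 8 → ℤ := fun i => if (f (nikVec i)).1 = 0 then 0 else 1
  have hc : (2 : ℤ) • (((f nh).1, 0) : E2T) = f (∑ i, c i • nikVec i) := by
    have h1 : (2 : ℤ) • (f nh).1 = ∑ i, (f (nikVec i)).1 := by
      rw [← Prod.fst_sum, ← map_sum, ← hnh, map_smul]
      rfl
    rw [map_sum]
    refine Prod.ext ?_ ?_
    · rw [Prod.fst_sum]
      refine h1.trans (sum_congr rfl fun i _ => ?_)
      by_cases hi : (f (nikVec i)).1 = 0 <;> simp [c, hi]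
    · rw [Prod.snd_sum, Prod.smul_snd, smul_zero]
      refine (sum_eq_zero fun i _ => ?_).symm
      by_cases hi : (f (nikVec i)).1 = 0
      · simp [c, hi]
      · simp [(hroot i).resolve_left hi]
  obtain ⟨v, hv⟩ := hp _ 2 two_ne_zero ⟨_, hc.symm⟩
  have hv2 : (2 : ℤ) • v = ∑ i, c i • nikVec i := by
    apply hinj
    rw [map_smul, hv, hc]
  obtain ⟨m, a, ha⟩ := exists_coord_of_mem_Nik v.2
  have hcoord : ∀ i, 2 * a i + m = c i := fun i => by
    have h := congrFun (congrArg Subtype.val hv2) i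
    rw [coe_sum_smul_nikVec] at h
    simp [ha] at h
    have : (2 * a i + m : ℚ) = c i := by linarith
    exact_mod_cast this
  have h1 := hcoord s
  have h2 := hcoord t
  rw [show c s = 0 from if_pos ((hroot s).resolve_right hs)] at h1
  rw [show c t = 1 from if_neg ht] at h2
  omega

/-- there is no isometric embedding `j` of `N ⊕ N` into `E8(-1) ⊕ E8(-1)`
such that `j(N ⊕ {0})` is a primitive sublattice of `E8(-1) ⊕ E8(-1)`. -/
theorem no_primitive_embedding_NN_in_E8E8 :
    ¬ ∃ j : NN →ₗ[ℤ] E2T,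
      Function.Injective j ∧
      (∀ x y : NN, (bE2 (j x) (j y) : ℚ) = bNN (x : Qv × Qv) (y : Qv × Qv)) ∧
      (∀ (p : E2T) (n : ℤ), n ≠ 0 →
        n • p ∈ Submodule.map j ((Nik.prod ⊥).comap NN.subtype) →
        p ∈ Submodule.map j ((Nik.prod ⊥).comap NN.subtype)) := by
  rintro ⟨j, hinj, hj, hp⟩
  let ι : Nik →ₗ[ℤ] NN := (LinearMap.inl ℤ Qv Qv).restrict fun x hx => ⟨hx, zero_mem _⟩
  have hrange : Submodule.map j ((Nik.prod ⊥).comap NN.subtype) = LinearMap.range (j ∘ₗ ι) := by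
    rw [LinearMap.range_comp]
    congr 1
    ext ⟨⟨x, y⟩, hx, hy⟩
    constructor
    · rintro ⟨_, h⟩
      refine ⟨⟨x, hx⟩, Subtype.ext (Prod.ext rfl ?_)⟩
      exact ((Submodule.mem_bot ℤ).1 h).symm
    · rintro ⟨v, hv⟩
      rw [← hv]
      exact ⟨v.2, zero_mem _⟩
  rw [hrange] at hp
  refine no_primitive_embedding_Nik (j ∘ₗ ι) (hinj.comp fun x y h => ?_) (fun x y => ?_) hp
  · exact Subtype.ext (congrArg (fun z : NN => (z : Qv × Qv).1) h)
  · refine (hj (ι x) (ι y)).trans ?_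
    change bN x y + bN 0 0 = bN x y
    simp [bN]
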